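/- Let P be a graded poset of rank r and κ > 0. For every π ∈ F^B_κ(P) and every x ∈ P of rank i, (Rvac^B_F π)(x) = ((Row^B_F)^{i+1} π)(x). -/

import Mathlib

open scoped Classical

noncomputable section

/-- `P̂`: the poset `P` with a new minimum `0̂` and a new maximum `1̂` adjoined. -/
abbrev Phat (P : Type) := WithBot (WithTop P)

instance {P : Type} [Fintype P] : Fintype (Phat P) :=
  inferInstanceAs (Fintype (Option (Option P)))

/-- The inclusion of `P` into `P̂`. -/
def emb {P : Type} (p : P) : Phat P := ((p : WithTop P) : WithBot (WithTop P))

/-- The new maximum `1̂` of `P̂`. -/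
def topHat (P : Type) : Phat P := ((⊤ : WithTop P) : WithBot (WithTop P))

variable {P : Type} [Fintype P] [PartialOrder P]

/-- `∑_{y ⋖ x} π(y)`. -/
def covSumBelow (π : Phat P → ℝ) (x : Phat P) : ℝ :=
  ∑ y : Phat P, if y ⋖ x then π y else 0

/-- `∑_{x ⋖ y} 1/π(y)`. -/
def covSumAboveInv (π : Phat P → ℝ) (x : Phat P) : ℝ :=
  ∑ y : Phat P, if x ⋖ y then (π y)⁻¹ else 0

/-- The birational order-filter rank toggle `𝐭_i`, in simultaneous form (it agrees with the
composition of the pairwise commuting birational order filter toggles `t_p` over `p ∈ P_i`,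
since a toggle `t_p` only changes the value at `p` and only reads values at `p` and at
elements covering or covered by `p`, which have different ranks). -/
def rankToggleB (rk : P → ℕ) (i : ℕ) (π : Phat P → ℝ) : Phat P → ℝ :=
  fun x =>
    if ∃ p : P, rk p = i ∧ x = emb p then
      covSumBelow π x / (π x * covSumAboveInv π x)
    else π x

/-- Apply a word of rank toggles; the head of the list is applied last, matching the
convention that in a product `𝐭_{i_1} 𝐭_{i_2} ⋯ 𝐭_{i_k}` the rightmost factor acts first. -/
def applyB (rk : P → ℕ) : List ℕ → (Phat P → ℝ) → Phat P → ℝ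
  | [] => fun π => π
  | i :: w => fun π => rankToggleB rk i (applyB rk w π)

/-- The word `𝐭_0 𝐭_1 ⋯ 𝐭_r` for rowmotion. -/
def rowWordB (r : ℕ) : List ℕ := List.range (r + 1)

/-- The word `(𝐭_r)(𝐭_{r-1} 𝐭_r) ⋯ (𝐭_0 𝐭_1 ⋯ 𝐭_r)` for rowvacuation. -/
def rvacWordB (r : ℕ) : List ℕ :=
  (List.range (r + 1)).foldr (fun k acc => (List.range (r + 1)).drop (r - k) ++ acc) []

/-- The word `(𝐭_0)(𝐭_1 𝐭_0) ⋯ (𝐭_r 𝐭_{r-1} ⋯ 𝐭_0)` for dual rowvacuation. -/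
def drvacWordB (r : ℕ) : List ℕ :=
  (List.range (r + 1)).foldr (fun k acc => (List.range (k + 1)).reverse ++ acc) []

/-- Birational order filter rowmotion `Row^B_F = 𝐭_0 𝐭_1 ⋯ 𝐭_r`. -/
def RowB (rk : P → ℕ) (r : ℕ) : (Phat P → ℝ) → Phat P → ℝ := applyB rk (rowWordB r)

/-- The inverse of birational order filter rowmotion, `(Row^B_F)⁻¹ = 𝐭_r ⋯ 𝐭_1 𝐭_0`
(each toggle is an involution, so the reversed word gives the inverse map). -/
def RowInvB (rk : P → ℕ) (r : ℕ) : (Phat P → ℝ) → Phat P → ℝ := applyB rk (rowWordB r).reverse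

/-- Birational order filter rowvacuation `Rvac^B_F`. -/
def RvacB (rk : P → ℕ) (r : ℕ) : (Phat P → ℝ) → Phat P → ℝ := applyB rk (rvacWordB r)

/-- Birational order filter dual rowvacuation `DRvac^B_F`. -/
def DRvacB (rk : P → ℕ) (r : ℕ) : (Phat P → ℝ) → Phat P → ℝ := applyB rk (drvacWordB r)

end

section RankToggles

variable {P : Type}

/-- The labelings `π` and `σ` agree at `0̂`, at `1̂`, and at every `p` with `m ≤ rk p + 1`. -/
def AgreeAbove (rk : P → ℕ) (m : ℕ) (π σ : Phat P → ℝ) : Prop :=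
  ∀ y, (∀ p, y = emb p → m ≤ rk p + 1) → π y = σ y

theorem AgreeAbove.mono {rk : P → ℕ} {m n : ℕ} {π σ : Phat P → ℝ} (h : AgreeAbove rk m π σ)
    (hmn : m ≤ n) : AgreeAbove rk n π σ :=
  fun y hy => h y fun p hp => hmn.trans (hy p hp)

theorem AgreeAbove.trans {rk : P → ℕ} {m : ℕ} {π σ τ : Phat P → ℝ} (h : AgreeAbove rk m π σ)
    (h' : AgreeAbove rk m σ τ) : AgreeAbove rk m π τ :=
  fun y hy => (h y hy).trans (h' y hy)

theorem AgreeAbove.symm {rk : P → ℕ} {m : ℕ} {π σ : Phat P → ℝ} (h : AgreeAbove rk m π σ) :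
    AgreeAbove rk m σ π :=
  fun y hy => (h y hy).symm

variable [PartialOrder P]

theorem emb_covBy_emb {p q : P} (h : emb p ⋖ emb q) : p ⋖ q := by
  simpa [emb, WithBot.coe_covBy_coe, WithTop.coe_covBy_coe] using h

theorem rk_le_of_forall_covBy [Finite P] {rk : P → ℕ} {r : ℕ}
    (hcov : ∀ x y : P, x ⋖ y → rk y = rk x + 1) (hmax : ∀ x : P, IsMax x → rk x = r) (x : P) :
    rk x ≤ r := by
  induction x using WellFoundedGT.induction with
  | ind x ih =>
    by_cases hx : IsMax x
    · exact (hmax x hx).le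
    · obtain ⟨y, hy⟩ := exists_covBy_of_wellFoundedLT hx
      have := ih y hy.lt
      have := hcov x y hy
      omega

variable [Fintype P]

theorem rankToggleB_agreeAbove_rankToggleB {rk : P → ℕ}
    (hcov : ∀ x y : P, x ⋖ y → rk y = rk x + 1) {m i : ℕ} (hi : m ≤ i)
    {π σ : Phat P → ℝ} (h : AgreeAbove rk m π σ) :
    AgreeAbove rk m (rankToggleB rk i π) (rankToggleB rk i σ) := by
  intro y hy
  unfold rankToggleB
  split_ifs with hp
  · obtain ⟨p, hp, rfl⟩ := hp
    have hbelow : covSumBelow π (emb p) = covSumBelow σ (emb p) := by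
      refine Finset.sum_congr rfl fun z _ => ?_
      split_ifs with hz
      · refine h z ?_
        rintro q rfl
        have := hcov q p (emb_covBy_emb hz)
        omega
      · rfl
    have habove : covSumAboveInv π (emb p) = covSumAboveInv σ (emb p) := by
      refine Finset.sum_congr rfl fun z _ => ?_
      split_ifs with hz
      · refine congrArg _ (h z ?_)
        rintro q rfl
        have := hcov p q (emb_covBy_emb hz)
        omega
      · rfl
    rw [hbelow, habove, h _ hy]
  · exact h y hy

theorem rankToggleB_agreeAbove_self (rk : P → ℕ) {m i : ℕ} (hi : i < m) (π : Phat P → ℝ) :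
    AgreeAbove rk (m + 1) (rankToggleB rk i π) π := by
  intro y hy
  refine if_neg ?_
  rintro ⟨p, hp, rfl⟩
  have := hy p rfl
  omega

theorem applyB_agreeAbove_applyB {rk : P → ℕ}
    (hcov : ∀ x y : P, x ⋖ y → rk y = rk x + 1) {m : ℕ} {w : List ℕ} (hw : ∀ i ∈ w, m ≤ i)
    {π σ : Phat P → ℝ} (h : AgreeAbove rk m π σ) :
    AgreeAbove rk m (applyB rk w π) (applyB rk w σ) := by
  induction w with
  | nil => exact h
  | cons i w ih =>
    exact rankToggleB_agreeAbove_rankToggleB hcov (hw i (by simp))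
      (ih fun j hj => hw j (by simp [hj]))

theorem applyB_agreeAbove_self (rk : P → ℕ) {m : ℕ} {w : List ℕ} (hw : ∀ i ∈ w, i < m)
    (π : Phat P → ℝ) : AgreeAbove rk (m + 1) (applyB rk w π) π := by
  induction w with
  | nil => exact fun _ _ => rfl
  | cons i w ih =>
    exact (rankToggleB_agreeAbove_self rk (hw i (by simp)) _).trans
      (ih fun j hj => hw j (by simp [hj]))

theorem applyB_emb_of_forall_ne (rk : P → ℕ) {w : List ℕ} {x : P} (hw : ∀ i ∈ w, i ≠ rk x)
    (π : Phat P → ℝ) : applyB rk w π (emb x) = π (emb x) := by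
  induction w with
  | nil => rfl
  | cons i w ih =>
    refine (if_neg ?_).trans (ih fun j hj => hw j (by simp [hj]))
    rintro ⟨p, hp, hxp⟩
    obtain rfl : x = p := by simpa [emb] using hxp
    exact hw i (by simp) hp.symm

theorem applyB_append (rk : P → ℕ) (u v : List ℕ) (π : Phat P → ℝ) :
    applyB rk (u ++ v) π = applyB rk u (applyB rk v π) := by
  induction u with
  | nil => rfl
  | cons i u ih => exact congrArg (rankToggleB rk i) ih

end RankToggles

theorem le_of_mem_drop_range {n m i : ℕ} (h : i ∈ (List.range n).drop m) : m ≤ i := by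
  rw [List.range_eq_range', List.drop_range'] at h
  have := (List.mem_range'_1.mp h).1
  omega

/-- The word `(𝐭_{r-s}⋯𝐭_r)(𝐭_{r-s-1}⋯𝐭_r)⋯`, with `n` factors. -/
def rvacSegment (r s n : ℕ) : List ℕ :=
  ((List.range' s n).map fun k => (List.range (r + 1)).drop (r - k)).flatten

theorem rvacWordB_eq_append {r i : ℕ} (hi : i ≤ r) :
    rvacWordB r = rvacSegment r 0 (r - i) ++ rvacSegment r (r - i) (i + 1) := by
  have hfold : ∀ l : List ℕ,
      l.foldr (fun k acc => (List.range (r + 1)).drop (r - k) ++ acc) [] =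
        (l.map fun k => (List.range (r + 1)).drop (r - k)).flatten := by
    intro l
    induction l with
    | nil => rfl
    | cons k l ih => simp [ih]
  have hrange : List.range (r + 1) = List.range' 0 (r - i) ++ List.range' (r - i) (i + 1) := by
    have := List.range'_append_1 (s := 0) (m := r - i) (n := i + 1)
    rw [Nat.zero_add] at this
    rw [this, List.range_eq_range']
    congr 1
    omega
  rw [rvacWordB, hfold, rvacSegment, rvacSegment, ← List.flatten_append, ← List.map_append,
    ← hrange]

theorem lt_of_mem_rvacSegment {r i j : ℕ} (h : j ∈ rvacSegment r 0 (r - i)) : i < j := by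
  simp only [rvacSegment, List.mem_flatten, List.mem_map] at h
  obtain ⟨_, ⟨k, hk, rfl⟩, hj⟩ := h
  have := (List.mem_range'_1.mp hk).2
  have := le_of_mem_drop_range hj
  omega

theorem applyB_rvacSegment_agreeAbove {P : Type} [Fintype P] [PartialOrder P] {rk : P → ℕ}
    (hcov : ∀ x y : P, x ⋖ y → rk y = rk x + 1) (r : ℕ) (π : Phat P → ℝ) {n : ℕ}
    (hn : n ≤ r + 1) :
    AgreeAbove rk n (applyB rk (rvacSegment r (r + 1 - n) n) π) ((RowB rk r)^[n] π) := by
  induction n with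
  | zero => exact fun _ _ => rfl
  | succ n ih =>
    have hseg : rvacSegment r (r + 1 - (n + 1)) (n + 1) =
        (List.range (r + 1)).drop n ++ rvacSegment r (r + 1 - n) n := by
      rw [rvacSegment, List.range'_succ, List.map_cons, List.flatten_cons, rvacSegment,
        show r - (r + 1 - (n + 1)) = n by omega, show r + 1 - (n + 1) + 1 = r + 1 - n by omega]
    have hrow : ∀ σ : Phat P → ℝ, RowB rk r σ = applyB rk ((List.range (r + 1)).take n)
        (applyB rk ((List.range (r + 1)).drop n) σ) := by
      intro σ
      rw [← applyB_append, List.take_append_drop]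
      rfl
    rw [hseg, applyB_append, Function.iterate_succ_apply', hrow]
    refine ((applyB_agreeAbove_applyB hcov (fun _ => le_of_mem_drop_range)
      (ih (by omega))).mono n.le_succ).trans (applyB_agreeAbove_self rk ?_ _).symm
    intro i hi
    rw [List.take_range, List.mem_range] at hi
    omega

/-- Let `P` be a graded poset of rank `r` and `κ > 0`.  For every
`π ∈ F^B_κ(P)` and every `x ∈ P` of rank `i`,
`(Rvac^B_F π)(x) = ((Row^B_F)^(i+1) π)(x)`. -/
theorem stmt3 {P : Type} [Fintype P] [PartialOrder P] [Nonempty P]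
    (r : ℕ) (rk : P → ℕ)
    (hmin : ∀ x : P, IsMin x → rk x = 0)
    (hcov : ∀ x y : P, x ⋖ y → rk y = rk x + 1)
    (hmax : ∀ x : P, IsMax x → rk x = r)
    (κ : ℝ) (hκ : 0 < κ)
    (π : Phat P → ℝ) (hpos : ∀ x, 0 < π x)
    (h0 : π ⊥ = 1) (h1 : π (topHat P) = κ)
    (x : P) (i : ℕ) (hx : rk x = i) :
    RvacB rk r π (emb x) = (RowB rk r)^[i + 1] π (emb x) := by
  subst hx
  have hr := rk_le_of_forall_covBy hcov hmax x
  rw [RvacB, rvacWordB_eq_append hr, applyB_append,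
    applyB_emb_of_forall_ne rk fun j hj => (lt_of_mem_rvacSegment hj).ne']
  have h := applyB_rvacSegment_agreeAbove hcov r π (Nat.succ_le_succ hr) (emb x) (by
    intro p hp
    obtain rfl : x = p := by simpa [emb] using hp
    exact le_rfl)
  rwa [Nat.succ_sub_succ] at h
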